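/- arXiv:1907.04617 — 2 statements merged into one kernel-verified Lean document; each statement's English description precedes it below -/
import Mathlib

section
/- Let n > 1, let L be the second order cone in ℝ^n, ∂L its boundary, and J = diag(1,−1,…,−1). Then, as subsets of the symmetric matrices, ℝ·J − S^n_+ = ℝ·J − E_L = ℝ·J − E_{∂L}, where E_L and E_{∂L} are the copositive cones of L and ∂L respectively and S^n_+ is the positive semidefinite cone. -/
open Matrix

noncomputable section

/-- The second order cone in `ℝⁿ`: `{(t,u) : t ≥ ‖u‖}` (first coordinate is `t`). -/
def soc (n : ℕ) [NeZero n] : Set (Fin n → ℝ) :=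
  {x | Real.sqrt (∑ i, if i = 0 then 0 else (x i) ^ 2) ≤ x 0}

/-- The boundary of the second order cone: `{(t,u) : t = ‖u‖}`. -/
def socBd (n : ℕ) [NeZero n] : Set (Fin n → ℝ) :=
  {x | Real.sqrt (∑ i, if i = 0 then 0 else (x i) ^ 2) = x 0}

/-- `J = diag(1, -1, …, -1)`. -/
def Jmat (n : ℕ) [NeZero n] : Matrix (Fin n) (Fin n) ℝ :=
  Matrix.diagonal (fun i => if i = 0 then 1 else -1)

/-- The dual cone of a set `K ⊆ ℝⁿ`. -/
def dualCone {n : ℕ} (K : Set (Fin n → ℝ)) : Set (Fin n → ℝ) :=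
  {y | ∀ x ∈ K, 0 ≤ x ⬝ᵥ y}

/-- `A` is a Z-transformation on `K`: `x ∈ K`, `y ∈ K*`, `⟨x,y⟩ = 0` imply `⟨Ax,y⟩ ≤ 0`. -/
def IsZTransf {n : ℕ} (K : Set (Fin n → ℝ)) (A : Matrix (Fin n) (Fin n) ℝ) : Prop :=
  ∀ x ∈ K, ∀ y ∈ dualCone K, x ⬝ᵥ y = 0 → (A.mulVec x) ⬝ᵥ y ≤ 0

/-- The completely positive cone of `C`: all finite sums `∑ uᵢuᵢᵀ` with `uᵢ ∈ C`. -/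
def cpCone {n : ℕ} (C : Set (Fin n → ℝ)) : Set (Matrix (Fin n) (Fin n) ℝ) :=
  {X | ∃ (m : ℕ) (u : Fin m → Fin n → ℝ), (∀ i, u i ∈ C) ∧ X = ∑ i, vecMulVec (u i) (u i)}

/-- The copositive cone of `C`: symmetric matrices `A` with `xᵀAx ≥ 0` for all `x ∈ C`. -/
def copCone {n : ℕ} (C : Set (Fin n → ℝ)) : Set (Matrix (Fin n) (Fin n) ℝ) :=
  {A | Aᵀ = A ∧ ∀ x ∈ C, 0 ≤ x ⬝ᵥ A.mulVec x}

/-- `Ω = {(x,y) ∈ L × L : ‖x‖ = 1 = ‖y‖, ⟨x,y⟩ = 0}`. -/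
def OmegaSet (n : ℕ) [NeZero n] : Set ((Fin n → ℝ) × (Fin n → ℝ)) :=
  {p | p.1 ∈ soc n ∧ p.2 ∈ soc n ∧ Real.sqrt (∑ i, p.1 i ^ 2) = 1 ∧
       Real.sqrt (∑ i, p.2 i ^ 2) = 1 ∧ p.1 ⬝ᵥ p.2 = 0}

/-- `γ(A) = max {⟨Ax,y⟩ : (x,y) ∈ Ω}`. -/
def gammaFun (n : ℕ) [NeZero n] (A : Matrix (Fin n) (Fin n) ℝ) : ℝ :=
  sSup {r | ∃ p ∈ OmegaSet n, r = (A.mulVec p.1) ⬝ᵥ p.2}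

theorem quadForm_add_smul {m : Type*} [Fintype m] (A : Matrix m m ℝ) (x y : m → ℝ) (s : ℝ) :
    (x + s • y) ⬝ᵥ A *ᵥ (x + s • y) =
      x ⬝ᵥ A *ᵥ x + s * (x ⬝ᵥ A *ᵥ y + y ⬝ᵥ A *ᵥ x) + s ^ 2 * (y ⬝ᵥ A *ᵥ y) := by
  simp only [mulVec_add, mulVec_smul, dotProduct_add, add_dotProduct, smul_dotProduct,
    dotProduct_smul, smul_eq_mul]
  ring

/-- A real quadratic with positive leading and negative constant coefficient has a root of
each sign. -/
theorem exists_neg_root_pos_root {a b c : ℝ} (ha : 0 < a) (hc : c < 0) :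
    ∃ s t : ℝ, s < 0 ∧ 0 < t ∧ c + s * b + s ^ 2 * a = 0 ∧ c + t * b + t ^ 2 * a = 0 ∧
      s * t * a = c := by
  have hd : b ^ 2 < b ^ 2 - 4 * a * c := by nlinarith [mul_neg_of_pos_of_neg ha hc]
  have hsq : √(b ^ 2 - 4 * a * c) ^ 2 = b ^ 2 - 4 * a * c :=
    Real.sq_sqrt ((sq_nonneg b).trans hd.le)
  have hlt : |b| < √(b ^ 2 - 4 * a * c) := Real.lt_sqrt_of_sq_lt (by rwa [sq_abs])
  obtain ⟨h₁, h₂⟩ := abs_lt.mp hlt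
  refine ⟨(-b - √(b ^ 2 - 4 * a * c)) / (2 * a), (-b + √(b ^ 2 - 4 * a * c)) / (2 * a),
    div_neg_of_neg_of_pos (by linarith) (by linarith), div_pos (by linarith) (by linarith),
    ?_, ?_, ?_⟩ <;> generalize √(b ^ 2 - 4 * a * c) = r at hsq <;> field_simp <;>
    linarith

/-- If the form of `A` is nonnegative on the null vectors of the form of `S`, then its values at
`S`-negative and `S`-positive vectors are compatible with a common multiplier. -/
theorem quadForm_cross_le {m : Type*} [Fintype m] {A S : Matrix m m ℝ}
    (h : ∀ z, z ⬝ᵥ S *ᵥ z = 0 → 0 ≤ z ⬝ᵥ A *ᵥ z) {x y : m → ℝ}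
    (hx : x ⬝ᵥ S *ᵥ x < 0) (hy : 0 < y ⬝ᵥ S *ᵥ y) :
    -(y ⬝ᵥ A *ᵥ y) / (y ⬝ᵥ S *ᵥ y) ≤ (x ⬝ᵥ A *ᵥ x) / -(x ⬝ᵥ S *ᵥ x) := by
  obtain ⟨s, t, hs, ht, hs0, ht0, hst⟩ :=
    exists_neg_root_pos_root (b := x ⬝ᵥ S *ᵥ y + y ⬝ᵥ S *ᵥ x) hy hx
  have h₁ := h (x + s • y) (by rw [quadForm_add_smul, hs0])
  have h₂ := h (x + t • y) (by rw [quadForm_add_smul, ht0])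
  rw [quadForm_add_smul] at h₁ h₂
  have h₃ : 0 ≤ (t - s) * (x ⬝ᵥ A *ᵥ x - s * t * (y ⬝ᵥ A *ᵥ y)) := by
    linear_combination mul_nonneg ht.le h₁ + mul_nonneg (neg_nonneg.mpr hs.le) h₂
  have h₄ := nonneg_of_mul_nonneg_right h₃ (by linarith)
  rw [div_le_div_iff₀ hy (by linarith)]
  have h₅ := mul_nonneg hy.le h₄
  linear_combination h₅ - (y ⬝ᵥ A *ᵥ y) * hst

/-- Finsler's lemma (the homogeneous S-lemma with equality) for an indefinite form. -/
theorem exists_multiplier_of_nonneg_on_null {m : Type*} [Fintype m] {A S : Matrix m m ℝ}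
    (h : ∀ z, z ⬝ᵥ S *ᵥ z = 0 → 0 ≤ z ⬝ᵥ A *ᵥ z)
    (hneg : ∃ x, x ⬝ᵥ S *ᵥ x < 0) (hpos : ∃ y, 0 < y ⬝ᵥ S *ᵥ y) :
    ∃ γ : ℝ, ∀ z, 0 ≤ z ⬝ᵥ (A + γ • S) *ᵥ z := by
  obtain ⟨x₀, hx₀⟩ := hneg
  obtain ⟨y₀, hy₀⟩ := hpos
  obtain ⟨γ, hγ₁, hγ₂⟩ := exists_between_of_forall_le
    (s := {r | ∃ y, 0 < y ⬝ᵥ S *ᵥ y ∧ r = -(y ⬝ᵥ A *ᵥ y) / (y ⬝ᵥ S *ᵥ y)})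
    (t := {r | ∃ x, x ⬝ᵥ S *ᵥ x < 0 ∧ r = (x ⬝ᵥ A *ᵥ x) / -(x ⬝ᵥ S *ᵥ x)})
    ⟨_, y₀, hy₀, rfl⟩ ⟨_, x₀, hx₀, rfl⟩
    (by rintro _ ⟨y, hy, rfl⟩ _ ⟨x, hx, rfl⟩; exact quadForm_cross_le h hx hy)
  refine ⟨γ, fun z => ?_⟩
  rw [add_mulVec, dotProduct_add, smul_mulVec, dotProduct_smul, smul_eq_mul]
  rcases lt_trichotomy (z ⬝ᵥ S *ᵥ z) 0 with hz | hz | hz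
  · have := hγ₂ ⟨z, hz, rfl⟩
    rw [le_div_iff₀ (by linarith)] at this
    linarith
  · simpa [hz] using h z hz
  · have := hγ₁ ⟨z, hz, rfl⟩
    rw [div_le_iff₀ hz] at this
    linarith

theorem dotProduct_Jmat_mulVec (n : ℕ) [NeZero n] (x : Fin n → ℝ) :
    x ⬝ᵥ Jmat n *ᵥ x = x 0 ^ 2 - ∑ i, if i = 0 then 0 else (x i) ^ 2 := by
  have h : x 0 ^ 2 = ∑ i, if i = 0 then x i ^ 2 else 0 := by simp
  rw [h, ← Finset.sum_sub_distrib, dotProduct]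
  refine Finset.sum_congr rfl fun i _ => ?_
  rw [Jmat, mulVec_diagonal]
  split_ifs <;> ring

theorem Jmat_isHermitian (n : ℕ) [NeZero n] : (Jmat n).IsHermitian := by
  simp [Jmat, IsHermitian]

theorem mem_socBd_or_neg_mem_socBd {n : ℕ} [NeZero n] {x : Fin n → ℝ}
    (hx : x ⬝ᵥ Jmat n *ᵥ x = 0) : x ∈ socBd n ∨ -x ∈ socBd n := by
  rw [dotProduct_Jmat_mulVec, sub_eq_zero] at hx
  rcases le_total 0 (x 0) with h | h
  · left
    rw [socBd, Set.mem_ofPred_eq, ← hx, Real.sqrt_sq h]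
  · right
    simp only [socBd, Set.mem_ofPred_eq, Pi.neg_apply, neg_sq]
    rw [← hx, Real.sqrt_sq_eq_abs, abs_of_nonpos h]

theorem copCone_anti {n : ℕ} {C D : Set (Fin n → ℝ)} (h : C ⊆ D) : copCone D ⊆ copCone C :=
  fun _ hA => ⟨hA.1, fun x hx => hA.2 x (h hx)⟩

theorem Matrix.PosSemidef.mem_copCone {n : ℕ} {A : Matrix (Fin n) (Fin n) ℝ}
    (hA : A.PosSemidef) (C : Set (Fin n → ℝ)) : A ∈ copCone C := by
  refine ⟨by simpa [IsHermitian, conjTranspose_eq_transpose_of_trivial] using hA.isHermitian,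
    fun x _ => ?_⟩
  simpa using hA.dotProduct_mulVec_nonneg x

theorem socBd_subset_soc (n : ℕ) [NeZero n] : socBd n ⊆ soc n :=
  fun _ hx => le_of_eq hx

theorem exists_posSemidef_add_smul_Jmat {n : ℕ} [NeZero n] (hn : 1 < n)
    {A : Matrix (Fin n) (Fin n) ℝ} (hA : A ∈ copCone (socBd n)) :
    ∃ γ : ℝ, (A + γ • Jmat n).PosSemidef := by
  have hnull (z : Fin n → ℝ) (hz : z ⬝ᵥ Jmat n *ᵥ z = 0) : 0 ≤ z ⬝ᵥ A *ᵥ z := by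
    rcases mem_socBd_or_neg_mem_socBd hz with h | h
    · exact hA.2 z h
    · simpa [mulVec_neg] using hA.2 _ h
  have hne : (⟨1, hn⟩ : Fin n) ≠ 0 := by simp [Fin.ext_iff]
  obtain ⟨γ, hγ⟩ := exists_multiplier_of_nonneg_on_null hnull
    ⟨Pi.single ⟨1, hn⟩ 1, by simp [Jmat, hne]⟩ ⟨Pi.single 0 1, by simp [Jmat]⟩
  refine ⟨γ, PosSemidef.of_dotProduct_mulVec_nonneg ?_ fun x => by simpa using hγ x⟩
  have hA' : A.IsHermitian := by
    rw [IsHermitian, conjTranspose_eq_transpose_of_trivial, hA.1]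
  exact hA'.add ((Jmat_isHermitian n).smul (IsSelfAdjoint.all γ))

theorem setOf_posSemidef_eq_setOf_copCone {n : ℕ} [NeZero n] (hn : 1 < n)
    {C : Set (Fin n → ℝ)} (hC : socBd n ⊆ C) :
    {M : Matrix (Fin n) (Fin n) ℝ | ∃ (γ : ℝ) (X : Matrix (Fin n) (Fin n) ℝ),
        X.PosSemidef ∧ M = γ • Jmat n - X} =
      {M : Matrix (Fin n) (Fin n) ℝ | ∃ (γ : ℝ) (X : Matrix (Fin n) (Fin n) ℝ),
        X ∈ copCone C ∧ M = γ • Jmat n - X} := by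
  ext M
  constructor
  · rintro ⟨γ, X, hX, rfl⟩
    exact ⟨γ, X, hX.mem_copCone C, rfl⟩
  · rintro ⟨γ, X, hX, rfl⟩
    obtain ⟨δ, hδ⟩ := exists_posSemidef_add_smul_Jmat hn (copCone_anti hC hX)
    exact ⟨γ + δ, X + δ • Jmat n, hδ, by rw [add_smul]; abel⟩

theorem stmt9 (n : ℕ) [NeZero n] (hn : 1 < n) :
    ({M : Matrix (Fin n) (Fin n) ℝ | ∃ (γ : ℝ) (X : Matrix (Fin n) (Fin n) ℝ),
        X.PosSemidef ∧ M = γ • Jmat n - X} =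
      {M : Matrix (Fin n) (Fin n) ℝ | ∃ (γ : ℝ) (X : Matrix (Fin n) (Fin n) ℝ),
        X ∈ copCone (soc n) ∧ M = γ • Jmat n - X}) ∧
    ({M : Matrix (Fin n) (Fin n) ℝ | ∃ (γ : ℝ) (X : Matrix (Fin n) (Fin n) ℝ),
        X.PosSemidef ∧ M = γ • Jmat n - X} =
      {M : Matrix (Fin n) (Fin n) ℝ | ∃ (γ : ℝ) (X : Matrix (Fin n) (Fin n) ℝ),
        X ∈ copCone (socBd n) ∧ M = γ • Jmat n - X}) := by
  exact ⟨setOf_posSemidef_eq_setOf_copCone hn (socBd_subset_soc n),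
    setOf_posSemidef_eq_setOf_copCone hn subset_rfl⟩
end
end

section
/- Let n > 1 and let L be the second order cone in ℝ^n. A matrix A ∈ ℝ^{n×n} is a strict Z-transformation on L (i.e., for all nonzero x, y ∈ L with ⟨x,y⟩ = 0 one has ⟨Ax,y⟩ < 0) if and only if there exist θ ∈ ℝ, a symmetric matrix P that is strictly copositive on ∂L (i.e., xᵀPx > 0 for all nonzero x ∈ ∂L), and a skew-symmetric matrix Q such that A = θ·I − J(P + Q), where J = diag(1,−1,…,−1). -/
open Matrix

noncomputable section

lemma mem_soc_iff {n : ℕ} [NeZero n] (x : Fin n → ℝ) :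
    x ∈ soc n ↔ 0 ≤ x 0 ∧ (∑ i, if i = 0 then 0 else (x i) ^ 2) ≤ x 0 ^ 2 :=
  Real.sqrt_le_iff

lemma sum_tail_sq_nonneg {n : ℕ} [NeZero n] (x : Fin n → ℝ) :
    0 ≤ ∑ i, if i = 0 then 0 else (x i) ^ 2 :=
  Finset.sum_nonneg fun i _ => by split_ifs <;> positivity

lemma mem_socBd_iff {n : ℕ} [NeZero n] (x : Fin n → ℝ) :
    x ∈ socBd n ↔ 0 ≤ x 0 ∧ (∑ i, if i = 0 then 0 else (x i) ^ 2) = x 0 ^ 2 := by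
  constructor
  · intro h
    change Real.sqrt _ = _ at h
    rw [← h]
    exact ⟨Real.sqrt_nonneg _, (Real.sq_sqrt (sum_tail_sq_nonneg x)).symm⟩
  · rintro ⟨h0, h⟩
    change Real.sqrt _ = _
    rw [h, Real.sqrt_sq h0]

lemma dotProduct_eq_head_add_tail {n : ℕ} [NeZero n] (x y : Fin n → ℝ) :
    x ⬝ᵥ y = x 0 * y 0 + ∑ i, if i = 0 then 0 else x i * y i := by
  have h : x 0 * y 0 = ∑ i, if i = 0 then x i * y i else 0 := by simp
  rw [h, ← Finset.sum_add_distrib]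
  exact Finset.sum_congr rfl fun i _ => by split_ifs <;> simp

lemma Jmat_mulVec_apply {n : ℕ} [NeZero n] (x : Fin n → ℝ) (i : Fin n) :
    (Jmat n).mulVec x i = if i = 0 then x i else -x i := by
  rw [Jmat, mulVec_diagonal]
  split_ifs <;> simp

lemma Jmat_mul_Jmat (n : ℕ) [NeZero n] : Jmat n * Jmat n = 1 := by
  rw [Jmat, diagonal_mul_diagonal, ← diagonal_one]
  congr 1
  ext i
  split_ifs <;> simp

lemma Jmat_transpose (n : ℕ) [NeZero n] : (Jmat n)ᵀ = Jmat n :=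
  diagonal_transpose _

lemma mulVec_dotProduct_Jmat_mulVec {n : ℕ} [NeZero n] (A : Matrix (Fin n) (Fin n) ℝ)
    (x : Fin n → ℝ) :
    A.mulVec x ⬝ᵥ (Jmat n).mulVec x = x ⬝ᵥ (Jmat n * A).mulVec x := by
  rw [dotProduct_mulVec, ← mulVec_transpose, Jmat_transpose, mulVec_mulVec, dotProduct_comm]

lemma dotProduct_transpose_mulVec_self {n : ℕ} (B : Matrix (Fin n) (Fin n) ℝ)
    (x : Fin n → ℝ) : x ⬝ᵥ Bᵀ.mulVec x = x ⬝ᵥ B.mulVec x := by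
  rw [mulVec_transpose, dotProduct_comm, ← dotProduct_mulVec]

lemma soc_head_pos {n : ℕ} [NeZero n] {x : Fin n → ℝ} (hx : x ∈ soc n) (hx0 : x ≠ 0) :
    0 < x 0 := by
  obtain ⟨h0, h⟩ := (mem_soc_iff x).1 hx
  refine lt_of_le_of_ne h0 fun h00 => hx0 ?_
  have hs : (∑ i, if i = 0 then 0 else (x i) ^ 2) = 0 :=
    le_antisymm (by simpa [← h00] using h) (sum_tail_sq_nonneg x)
  rw [Finset.sum_eq_zero_iff_of_nonneg fun i _ => by split_ifs <;> positivity] at hs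
  ext i
  by_cases hi : i = 0
  · rw [hi, ← h00, Pi.zero_apply]
  · simpa [hi] using hs i (Finset.mem_univ i)

/-- Nonzero orthogonal vectors of the second order cone lie on its boundary, and each is a
positive multiple of the reflection of the other. -/
lemma soc_orthogonal {n : ℕ} [NeZero n] {x y : Fin n → ℝ} (hx : x ∈ soc n) (hy : y ∈ soc n)
    (hx0 : x ≠ 0) (hy0 : y ≠ 0) (hxy : x ⬝ᵥ y = 0) :
    x ∈ socBd n ∧ ∃ c : ℝ, 0 < c ∧ y = c • (Jmat n).mulVec x := by
  have px := soc_head_pos hx hx0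
  have py := soc_head_pos hy hy0
  have sx := ((mem_soc_iff x).1 hx).2
  have sy := ((mem_soc_iff y).1 hy).2
  rw [dotProduct_eq_head_add_tail] at hxy
  have key : (∑ i, if i = 0 then 0 else (x 0 * y i + y 0 * x i) ^ 2) =
      x 0 ^ 2 * (∑ i, if i = 0 then 0 else (y i) ^ 2) +
      2 * (x 0 * y 0) * (∑ i, if i = 0 then 0 else x i * y i) +
      y 0 ^ 2 * (∑ i, if i = 0 then 0 else (x i) ^ 2) := by
    simp only [Finset.mul_sum, ← Finset.sum_add_distrib]
    exact Finset.sum_congr rfl fun i _ => by split_ifs <;> ring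
  have hnonneg : ∀ i ∈ Finset.univ, (0 : ℝ) ≤ if i = 0 then 0 else (x 0 * y i + y 0 * x i) ^ 2 :=
    fun i _ => by split_ifs <;> positivity
  have hge := Finset.sum_nonneg hnonneg
  have hcross : (∑ i, if i = 0 then 0 else x i * y i) = -(x 0 * y 0) := by linarith
  have h1 := mul_le_mul_of_nonneg_left sy (sq_nonneg (x 0))
  have h2 := mul_le_mul_of_nonneg_left sx (sq_nonneg (y 0))
  rw [hcross] at key
  have hzero : (∑ i, if i = 0 then 0 else (x 0 * y i + y 0 * x i) ^ 2) = 0 := by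
    nlinarith
  refine ⟨(mem_socBd_iff x).2 ⟨px.le, ?_⟩, y 0 / x 0, by positivity, ?_⟩
  · have : y 0 ^ 2 * (∑ i, if i = 0 then 0 else (x i) ^ 2) = y 0 ^ 2 * x 0 ^ 2 := by
      nlinarith
    exact mul_left_cancel₀ (by positivity) this
  · rw [Finset.sum_eq_zero_iff_of_nonneg hnonneg] at hzero
    ext i
    rw [Pi.smul_apply, smul_eq_mul, Jmat_mulVec_apply]
    by_cases hi : i = 0
    · subst hi
      simp [px.ne']
    · have hi' : x 0 * y i + y 0 * x i = 0 := by
        simpa [hi] using hzero i (Finset.mem_univ i)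
      rw [if_neg hi]
      field_simp
      linarith

lemma self_dotProduct_Jmat_mulVec_of_mem_socBd {n : ℕ} [NeZero n] {x : Fin n → ℝ}
    (hx : x ∈ socBd n) : x ⬝ᵥ (Jmat n).mulVec x = 0 := by
  have h := ((mem_socBd_iff x).1 hx).2
  have ht : (∑ i, if i = 0 then 0 else x i * (Jmat n).mulVec x i) =
      -∑ i, if i = 0 then 0 else (x i) ^ 2 := by
    rw [← Finset.sum_neg_distrib]
    exact Finset.sum_congr rfl fun i _ => by
      rw [Jmat_mulVec_apply]
      split_ifs <;> ring
  rw [dotProduct_eq_head_add_tail, ht, h, Jmat_mulVec_apply, if_pos rfl]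
  ring

lemma Jmat_mulVec_mem_soc {n : ℕ} [NeZero n] {x : Fin n → ℝ} (hx : x ∈ soc n) :
    (Jmat n).mulVec x ∈ soc n := by
  obtain ⟨h0, h⟩ := (mem_soc_iff x).1 hx
  rw [mem_soc_iff, Jmat_mulVec_apply, if_pos rfl]
  refine ⟨h0, le_trans (le_of_eq ?_) h⟩
  exact Finset.sum_congr rfl fun i _ => by
    rw [Jmat_mulVec_apply]
    split_ifs <;> ring

/-- Strict Z-transformations on the second order cone are exactly the matrices `A` for which
the quadratic form of `J * A` is negative on the boundary. -/
lemma strict_Z_iff_neg_on_socBd {n : ℕ} [NeZero n] (A : Matrix (Fin n) (Fin n) ℝ) :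
    (∀ x ∈ soc n, ∀ y ∈ soc n, x ≠ 0 → y ≠ 0 → x ⬝ᵥ y = 0 → (A.mulVec x) ⬝ᵥ y < 0) ↔
      ∀ x ∈ socBd n, x ≠ 0 → x ⬝ᵥ (Jmat n * A).mulVec x < 0 := by
  constructor
  · intro h x hx hx0
    have hxs : x ∈ soc n := le_of_eq hx
    rw [← mulVec_dotProduct_Jmat_mulVec]
    refine h x hxs _ (Jmat_mulVec_mem_soc hxs) hx0 (fun hJ => hx0 ?_)
      (self_dotProduct_Jmat_mulVec_of_mem_socBd hx)
    rw [← one_mulVec x, ← Jmat_mul_Jmat, ← mulVec_mulVec, hJ, mulVec_zero]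
  · intro h x hx y hy hx0 hy0 hxy
    obtain ⟨hxb, c, hc, rfl⟩ := soc_orthogonal hx hy hx0 hy0 hxy
    rw [dotProduct_smul, smul_eq_mul, mulVec_dotProduct_Jmat_mulVec]
    exact mul_neg_of_pos_of_neg hc (h x hxb hx0)

theorem stmt10 (n : ℕ) [NeZero n] (hn : 1 < n) (A : Matrix (Fin n) (Fin n) ℝ) :
    (∀ x ∈ soc n, ∀ y ∈ soc n, x ≠ 0 → y ≠ 0 → x ⬝ᵥ y = 0 → (A.mulVec x) ⬝ᵥ y < 0) ↔
      ∃ (θ : ℝ) (P Q : Matrix (Fin n) (Fin n) ℝ),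
        Pᵀ = P ∧ (∀ x ∈ socBd n, x ≠ 0 → 0 < x ⬝ᵥ P.mulVec x) ∧ Qᵀ = -Q ∧
        A = θ • (1 : Matrix (Fin n) (Fin n) ℝ) - Jmat n * (P + Q) := by
  rw [strict_Z_iff_neg_on_socBd]
  constructor
  · intro h
    set B := Jmat n * A with hB
    refine ⟨0, -(1 / 2 : ℝ) • (B + Bᵀ), -(1 / 2 : ℝ) • (B - Bᵀ), ?_, ?_, ?_, ?_⟩
    · rw [transpose_smul, transpose_add, transpose_transpose, add_comm]
    · intro x hx hx0
      rw [smul_mulVec, add_mulVec, dotProduct_smul, dotProduct_add,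
        dotProduct_transpose_mulVec_self, smul_eq_mul]
      linarith [h x hx hx0]
    · rw [transpose_smul, transpose_sub, transpose_transpose, ← smul_neg, neg_sub]
    · have hsum : -(1 / 2 : ℝ) • (B + Bᵀ) + -(1 / 2 : ℝ) • (B - Bᵀ) = -B := by
        module
      rw [hsum, hB, zero_smul, zero_sub, mul_neg, neg_neg, ← Matrix.mul_assoc, Jmat_mul_Jmat,
        Matrix.one_mul]
  · rintro ⟨θ, P, Q, -, hP, hQ, rfl⟩ x hx hx0
    have hQx : x ⬝ᵥ Q.mulVec x = 0 := by
      have := dotProduct_transpose_mulVec_self Q x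
      rw [hQ, neg_mulVec, dotProduct_neg] at this
      linarith
    rw [Matrix.mul_sub, ← Matrix.mul_assoc, Jmat_mul_Jmat, Matrix.one_mul, Matrix.mul_smul,
      Matrix.mul_one, sub_mulVec, smul_mulVec, add_mulVec, dotProduct_sub, dotProduct_smul,
      dotProduct_add, self_dotProduct_Jmat_mulVec_of_mem_socBd hx, hQx, smul_zero]
    linarith [hP x hx hx0]
end
end
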